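/- Let R be a commutative ring. The following conditions are equivalent: (1) R has almost stable range 1 (for every nonzero ideal I of R, the quotient ring R/I has stable range 1); (2) for each nonzero element z ∈ R, the quotient ring R/zR has stable range 1; (3) for any three elements x, y, z ∈ R with (x, y) = (1) and z ≠ 0, there exists an element λ ∈ R such that (x + λ·y, z) = (1). -/

import Mathlib

/-- A commutative ring has stable range 1. -/
def StableRangeOne (R : Type*) [CommRing R] : Prop :=
  ∀ x y : R, Ideal.span {x, y} = ⊤ → ∃ t : R, IsUnit (x + t * y)

theorem span_pair_top_iff {R : Type*} [CommRing R] (x y : R) :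
    Ideal.span {x, y} = ⊤ ↔ ∃ a b, a * x + b * y = 1 := by
  rw [Ideal.eq_top_iff_one, Ideal.mem_span_pair]

theorem asr_two_three {R : Type*} [CommRing R]
    (h : ∀ z : R, z ≠ 0 → StableRangeOne (R ⧸ Ideal.span ({z} : Set R)))
    (x y z : R) (hxy : Ideal.span {x, y} = ⊤) (hz : z ≠ 0) :
    ∃ lam : R, Ideal.span {x + lam * y, z} = ⊤ := by
  obtain ⟨a, b, hab⟩ := (span_pair_top_iff x y).1 hxy
  let f := Ideal.Quotient.mk (Ideal.span ({z} : Set R))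
  obtain ⟨t, ht⟩ := h z hz (f x) (f y) ((span_pair_top_iff _ _).2
    ⟨f a, f b, by rw [← map_mul, ← map_mul, ← map_add, hab, map_one]⟩)
  obtain ⟨l, rfl⟩ := Ideal.Quotient.mk_surjective t
  obtain ⟨u, hu⟩ := ht.exists_left_inv
  obtain ⟨u, rfl⟩ := Ideal.Quotient.mk_surjective u
  have h1 : f (u * (x + l * y)) = f 1 := by
    simpa [f] using hu
  obtain ⟨c, hc⟩ := Ideal.mem_span_singleton'.1 (Ideal.Quotient.eq.1 h1)
  exact ⟨l, (span_pair_top_iff _ _).2 ⟨u, -c, by linear_combination -hc⟩⟩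

theorem asr_three_one {R : Type*} [CommRing R]
    (h : ∀ x y z : R, Ideal.span {x, y} = ⊤ → z ≠ 0 →
        ∃ lam : R, Ideal.span {x + lam * y, z} = ⊤)
    (I : Ideal R) (hI : I ≠ ⊥) : StableRangeOne (R ⧸ I) := by
  intro x y hxy
  obtain ⟨z, hzI, hz⟩ := Submodule.exists_mem_ne_zero_of_ne_bot hI
  obtain ⟨a, b, hab⟩ := (span_pair_top_iff x y).1 hxy
  obtain ⟨x, rfl⟩ := Ideal.Quotient.mk_surjective x
  obtain ⟨y, rfl⟩ := Ideal.Quotient.mk_surjective y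
  obtain ⟨a, rfl⟩ := Ideal.Quotient.mk_surjective a
  obtain ⟨b, rfl⟩ := Ideal.Quotient.mk_surjective b
  obtain ⟨l, hl⟩ := h x (1 - a * x) z ((span_pair_top_iff _ _).2 ⟨a, 1, by ring⟩) hz
  obtain ⟨c, d, hcd⟩ := (span_pair_top_iff _ _).1 hl
  refine ⟨Ideal.Quotient.mk I (l * b), ?_⟩
  have h0 : Ideal.Quotient.mk I z = 0 := Ideal.Quotient.eq_zero_iff_mem.2 hzI
  have h1 := congrArg (Ideal.Quotient.mk I) hcd
  simp only [map_add, map_mul, map_sub, map_one, h0] at h1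
  refine IsUnit.of_mul_eq_one (Ideal.Quotient.mk I c) ?_
  rw [map_mul]
  linear_combination h1 + Ideal.Quotient.mk I c * Ideal.Quotient.mk I l * hab

/-- Characterizations of rings of almost stable range 1. -/
theorem almost_stable_range_one_tfae
    {R : Type*} [CommRing R] :
    ((∀ I : Ideal R, I ≠ ⊥ → StableRangeOne (R ⧸ I)) ↔
      (∀ z : R, z ≠ 0 → StableRangeOne (R ⧸ Ideal.span ({z} : Set R)))) ∧
    ((∀ z : R, z ≠ 0 → StableRangeOne (R ⧸ Ideal.span ({z} : Set R))) ↔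
      (∀ x y z : R, Ideal.span {x, y} = ⊤ → z ≠ 0 →
        ∃ lam : R, Ideal.span {x + lam * y, z} = ⊤)) := by
  refine ⟨⟨fun h z hz => h _ ?_, fun h => asr_three_one (asr_two_three h)⟩,
    asr_two_three, fun h z hz => asr_three_one h _ ?_⟩
  all_goals simpa [Ideal.span_singleton_eq_bot] using hz
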